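/- (Asymptotic expansion for simultaneous approximation, explicit form.) Let j ∈ ℤ, q ≥ 0 and m ≥ 0 integers, and x > 0. Let f ∈ E be such that f is (2q+2m−1) times differentiable on a neighborhood of x and f^(2q+2m-1) is differentiable at x. Then n^q · ( (S_{n,j}f)^{(m)}(x) − ∑_{k=0}^{q} n^{-k} ∑_{i=0}^{k} (x^i/i!) · ((k+m−j)↓(k−i)/(k−i)!) · f^{(k+m+i)}(x) ) → 0 as n → ∞, where (S_{n,j}f)^{(m)} denotes the m-th derivative of the function x ↦ (S_{n,j}f)(x). -/

import Mathlib

open MeasureTheory Real Filter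

/-- Szász basis function `s_{n,k}(x)` for natural index `k`. -/
noncomputable def szasz (n k : ℕ) (x : ℝ) : ℝ :=
  Real.exp (-(n : ℝ) * x) * ((n : ℝ) * x) ^ k / (Nat.factorial k)

/-- Szász basis function for integer index, vanishing for negative index. -/
noncomputable def szaszZ (n : ℕ) (k : ℤ) (x : ℝ) : ℝ :=
  if 0 ≤ k then szasz n k.toNat x else 0

/-- The generalized Szász–Mirakjan–Durrmeyer operator `S_{n,j}`. -/
noncomputable def Sop (n : ℕ) (j : ℤ) (f : ℝ → ℝ) (x : ℝ) : ℝ :=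
  f 0 * ∑ k ∈ Finset.range j.toNat, szasz n k x
    + ∑' (k : ℕ), szasz n k x *
        ((n : ℝ) * ∫ t in Set.Ioi (0 : ℝ), szaszZ n ((k : ℤ) - j) t * f t)

/-- Membership in the class `E_A`: locally integrable on `[0,∞)` with exponential growth. -/
def MemE (A : ℝ) (f : ℝ → ℝ) : Prop :=
  MeasureTheory.LocallyIntegrableOn f (Set.Ici 0) ∧
    ∃ K > 0, ∀ t ≥ (0 : ℝ), |f t| ≤ K * Real.exp (A * t)

/-- Falling factorial `a↓r = a(a-1)⋯(a-r+1)` for integer `a`. -/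
def ffall (a : ℤ) (r : ℕ) : ℤ := ∏ i ∈ Finset.range r, (a - i)

lemma ffall_div_factorial (a : ℤ) (r : ℕ) :
    (ffall a r : ℝ) / (r.factorial : ℝ) = (Ring.choose a r : ℤ) := by
  have h : ffall a r = r.factorial * Ring.choose a r := by
    rw [← nsmul_eq_mul, ← Ring.descPochhammer_eq_factorial_smul_choose,
      ← Polynomial.aeval_eq_smeval, Polynomial.coe_aeval_eq_eval,
      descPochhammer_eval_eq_prod_range, ffall]
  rw [h]
  push_cast
  field_simp

/-- The coefficient of `n⁻ᵏ` in the asymptotic expansion of `S_{n,j} g` at `x`, where `D l` is the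
`l`-th derivative of `g` at `x`. -/
noncomputable def szaszCoeff (j : ℤ) (x : ℝ) (D : ℕ → ℝ) (k : ℕ) : ℝ :=
  ∑ i ∈ Finset.range (k + 1),
    x ^ i / (i.factorial : ℝ) * (Ring.choose ((k : ℤ) - j) (k - i) : ℤ) * D (k + i)

lemma szaszCoeff_add (j : ℤ) (x : ℝ) (D E : ℕ → ℝ) (k : ℕ) :
    szaszCoeff j x (fun l => D l + E l) k = szaszCoeff j x D k + szaszCoeff j x E k := by
  simp only [szaszCoeff, mul_add, Finset.sum_add_distrib]

lemma szaszCoeff_const_mul (j : ℤ) (x c : ℝ) (D : ℕ → ℝ) (k : ℕ) :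
    szaszCoeff j x (fun l => c * D l) k = c * szaszCoeff j x D k := by
  simp only [szaszCoeff, Finset.mul_sum]
  exact Finset.sum_congr rfl fun i _ => by ring

lemma szaszCoeff_pow (j : ℤ) (x : ℝ) (r k : ℕ) :
    szaszCoeff j x (fun l => (r.descFactorial l : ℝ) * x ^ (r - l)) k =
      (r.descFactorial k : ℝ) * x ^ (r - k) * (Ring.choose ((r : ℤ) - j) k : ℤ) := by
  rcases lt_or_ge r k with hrk | hkr
  · rw [Nat.descFactorial_of_lt hrk, szaszCoeff, Finset.sum_eq_zero]
    · simp
    · intro i _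
      rw [Nat.descFactorial_of_lt (by omega)]
      simp
  · have hv := Ring.add_choose_eq k (Commute.all ((r - k : ℕ) : ℤ) ((k : ℤ) - j))
    rw [show ((r - k : ℕ) : ℤ) + ((k : ℤ) - j) = (r : ℤ) - j by omega,
      Finset.Nat.sum_antidiagonal_eq_sum_range_succ_mk] at hv
    rw [hv, szaszCoeff]
    push_cast
    rw [Finset.mul_sum]
    refine Finset.sum_congr rfl fun i hi => ?_
    rw [Ring.choose_natCast]
    rcases lt_or_ge (r - k) i with h | h
    · rw [Nat.descFactorial_of_lt (by omega : r < k + i), Nat.choose_eq_zero_of_lt h]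
      simp
    · have h1 : r.descFactorial (k + i) = r.descFactorial k * (i.factorial * (r - k).choose i) := by
        rw [← Nat.descFactorial_eq_factorial_mul_choose, mul_comm,
          ← Nat.descFactorial_mul_descFactorial (by omega : k ≤ k + i)]
        simp
      rw [h1, show r - k = i + (r - (k + i)) by omega, pow_add]
      push_cast
      field_simp

lemma szaszCoeff_zero (j : ℤ) (x : ℝ) (D : ℕ → ℝ) : szaszCoeff j x D 0 = D 0 := by
  simp [szaszCoeff]

lemma szaszCoeff_sub_one_sub (j : ℤ) (x : ℝ) (D : ℕ → ℝ) (k : ℕ) :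
    szaszCoeff (j - 1) x D (k + 1) - szaszCoeff j x D (k + 1) =
      szaszCoeff (j - 1) x (fun l => D (l + 1)) k := by
  rw [szaszCoeff, szaszCoeff, szaszCoeff, ← Finset.sum_sub_distrib, Finset.sum_range_succ]
  simp only [Nat.sub_self, Ring.choose_zero_right, sub_self, add_zero]
  refine Finset.sum_congr rfl fun i hi => ?_
  have hi' : i ≤ k := by simpa [Nat.lt_succ_iff] using hi
  have h := Ring.choose_succ_succ ((k : ℤ) - (j - 1)) (k - i)
  rw [show ((k + 1 : ℕ) : ℤ) - (j - 1) = (k : ℤ) - (j - 1) + 1 by push_cast; ring,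
    show ((k + 1 : ℕ) : ℤ) - j = (k : ℤ) - (j - 1) by push_cast; ring,
    show k + 1 - i = (k - i) + 1 by omega, h, show k + i + 1 = k + 1 + i by omega]
  push_cast
  ring

/-- Almost everywhere strongly measurable functions on `(0,∞)` bounded by a multiple of
`exp (A t)`. -/
def ExpBounded (A : ℝ) (g : ℝ → ℝ) : Prop :=
  AEStronglyMeasurable g (volume.restrict (Set.Ioi 0)) ∧
    ∃ K, ∀ t > (0 : ℝ), |g t| ≤ K * exp (A * t)

lemma ExpBounded.mono {A B : ℝ} {g : ℝ → ℝ} (hg : ExpBounded A g) (h : A ≤ B) :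
    ExpBounded B g := by
  obtain ⟨hm, K, hK⟩ := hg
  refine ⟨hm, |K|, fun t ht => (hK t ht).trans ?_⟩
  gcongr
  exact le_abs_self K

lemma ExpBounded.add {A : ℝ} {g h : ℝ → ℝ} (hg : ExpBounded A g) (hh : ExpBounded A h) :
    ExpBounded A (fun t => g t + h t) := by
  obtain ⟨hm, K, hK⟩ := hg
  obtain ⟨hm', L, hL⟩ := hh
  refine ⟨hm.add hm', K + L, fun t ht => (abs_add_le _ _).trans ?_⟩
  linarith [hK t ht, hL t ht]

lemma ExpBounded.const_mul {A : ℝ} {g : ℝ → ℝ} (hg : ExpBounded A g) (c : ℝ) :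
    ExpBounded A (fun t => c * g t) := by
  obtain ⟨hm, K, hK⟩ := hg
  refine ⟨hm.const_mul c, |c| * K, fun t ht => ?_⟩
  rw [abs_mul, mul_assoc]
  exact mul_le_mul_of_nonneg_left (hK t ht) (abs_nonneg c)

lemma expBounded_exp (A : ℝ) : ExpBounded A (fun t => exp (A * t)) :=
  ⟨by fun_prop, 1, fun t _ => by simp⟩

lemma ExpBounded.pow (r : ℕ) : ExpBounded 1 (fun t => t ^ r) := by
  refine ⟨by fun_prop, r.factorial, fun t ht => ?_⟩
  rw [abs_of_pos (pow_pos ht r), one_mul]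
  have := Real.pow_div_factorial_le_exp t ht.le r
  rwa [div_le_iff₀' (by positivity)] at this

lemma ExpBounded.polynomial (P : Polynomial ℝ) : ExpBounded 1 (fun t => P.eval t) := by
  induction P using Polynomial.induction_on' with
  | add p q hp hq => simpa using hp.add hq
  | monomial n a => simpa using (ExpBounded.pow n).const_mul a

lemma MemE.expBounded {A : ℝ} {f : ℝ → ℝ} (hf : MemE A f) : ExpBounded A f := by
  obtain ⟨hl, K, -, hK⟩ := hf
  exact ⟨hl.aestronglyMeasurable.mono_measure
    (Measure.restrict_mono Set.Ioi_subset_Ici_self le_rfl), K, fun t ht => hK t ht.le⟩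

lemma integral_pow_mul_exp_neg_mul (l : ℕ) {r : ℝ} (hr : 0 < r) :
    IntegrableOn (fun t : ℝ => t ^ l * exp (-(r * t))) (Set.Ioi 0) ∧
      ∫ t in Set.Ioi (0 : ℝ), t ^ l * exp (-(r * t)) = l.factorial / r ^ (l + 1) := by
  have hval : ∫ t in Set.Ioi (0 : ℝ), t ^ l * exp (-(r * t)) = l.factorial / r ^ (l + 1) := by
    have h := Real.integral_rpow_mul_exp_neg_mul_Ioi (a := l + 1) (by positivity) hr
    rw [Real.Gamma_nat_eq_factorial, add_sub_cancel_right] at h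
    simp only [Real.rpow_natCast] at h
    rw [h, show (l : ℝ) + 1 = ((l + 1 : ℕ) : ℝ) by push_cast; rfl, Real.rpow_natCast, one_div, inv_pow]
    field_simp
  refine ⟨?_, hval⟩
  by_contra hn
  rw [integral_undef hn] at hval
  have : (0 : ℝ) < l.factorial / r ^ (l + 1) := by positivity
  linarith

lemma szasz_nonneg (n k : ℕ) {t : ℝ} (ht : 0 ≤ t) : 0 ≤ szasz n k t := by
  unfold szasz; positivity

lemma szaszZ_nonneg (n : ℕ) (k : ℤ) {t : ℝ} (ht : 0 ≤ t) : 0 ≤ szaszZ n k t := by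
  unfold szaszZ
  split_ifs
  exacts [szasz_nonneg n _ ht, le_rfl]

lemma continuous_szaszZ (n : ℕ) (k : ℤ) : Continuous (szaszZ n k) := by
  unfold szaszZ szasz
  split_ifs
  · fun_prop
  · fun_prop

lemma integral_szasz_mul_exp (n l : ℕ) {A : ℝ} (hA : A < n) :
    IntegrableOn (fun t => szasz n l t * exp (A * t)) (Set.Ioi 0) ∧
      ∫ t in Set.Ioi (0 : ℝ), szasz n l t * exp (A * t) = n ^ l / (n - A) ^ (l + 1) := by
  have hr : 0 < n - A := sub_pos.2 hA
  obtain ⟨hi, hv⟩ := integral_pow_mul_exp_neg_mul l hr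
  have he : (fun t => szasz n l t * exp (A * t)) =
      fun t => ((n : ℝ) ^ l / l.factorial) * (t ^ l * exp (-((n - A) * t))) := by
    funext t
    rw [show -((n - A) * t) = -(n : ℝ) * t + A * t by ring, exp_add, szasz]
    ring
  refine ⟨he ▸ hi.const_mul _, ?_⟩
  rw [he, integral_const_mul, hv]
  field_simp

lemma integrableOn_szaszZ_mul_exp (n : ℕ) (k : ℤ) {A : ℝ} (hA : A < n) :
    IntegrableOn (fun t => szaszZ n k t * exp (A * t)) (Set.Ioi 0) := by
  unfold szaszZ
  split_ifs
  · exact (integral_szasz_mul_exp n _ hA).1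
  · simp

lemma integral_szaszZ_mul_exp_le {n : ℕ} (k : ℤ) {A : ℝ} (hA0 : 0 ≤ A) (hA : A < n) :
    n * ∫ t in Set.Ioi (0 : ℝ), szaszZ n k t * exp (A * t) ≤ (n / (n - A)) ^ (k + 1) := by
  have hr : 0 < n - A := sub_pos.2 hA
  have hn : (0 : ℝ) < n := hA0.trans_lt hA
  by_cases hk : 0 ≤ k
  · lift k to ℕ using hk
    have := (integral_szasz_mul_exp n k hA).2
    simp only [szaszZ, Int.natCast_nonneg, if_true, Int.toNat_natCast]
    rw [this, div_zpow, show (k : ℤ) + 1 = ((k + 1 : ℕ) : ℤ) by push_cast; rfl, zpow_natCast,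
      zpow_natCast]
    apply le_of_eq
    field_simp
    ring
  · simp only [szaszZ, hk, if_false, zero_mul, integral_zero, mul_zero]
    positivity

lemma ExpBounded.integrableOn_szaszZ_mul {A : ℝ} {g : ℝ → ℝ} (hg : ExpBounded A g) {n : ℕ}
    (hA : A < n) (k : ℤ) : IntegrableOn (fun t => szaszZ n k t * g t) (Set.Ioi 0) := by
  obtain ⟨hm, K, hK⟩ := hg
  refine ((integrableOn_szaszZ_mul_exp n k hA).const_mul K).mono'
    ((continuous_szaszZ n k).aestronglyMeasurable.mul hm) ?_
  filter_upwards [ae_restrict_mem measurableSet_Ioi] with t ht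
  rw [norm_mul, Real.norm_of_nonneg (szaszZ_nonneg n k (le_of_lt ht)), Real.norm_eq_abs]
  have := mul_le_mul_of_nonneg_left (hK t ht) (szaszZ_nonneg n k (le_of_lt ht))
  linarith

lemma ExpBounded.exists_integral_le {A : ℝ} {g : ℝ → ℝ} (hg : ExpBounded A g) (hA0 : 0 ≤ A)
    {n : ℕ} (hA : A < n) (j : ℤ) : ∃ C ρ : ℝ, 0 ≤ C ∧ 0 ≤ ρ ∧
      ∀ k : ℕ, |n * ∫ t in Set.Ioi (0 : ℝ), szaszZ n (k - j) t * g t| ≤ C * ρ ^ k := by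
  have hg' := hg
  obtain ⟨hm, K, hK⟩ := hg
  have hr : 0 < n - A := sub_pos.2 hA
  have hn : (0 : ℝ) < n := hA0.trans_lt hA
  have hρ : 0 < n / (n - A) := by positivity
  refine ⟨|K| * (n / (n - A)) ^ (1 - j), n / (n - A), by positivity, hρ.le, fun k => ?_⟩
  have h1 : |∫ t in Set.Ioi (0 : ℝ), szaszZ n (k - j) t * g t| ≤
      ∫ t in Set.Ioi (0 : ℝ), |K| * (szaszZ n (k - j) t * exp (A * t)) := by
    rw [← Real.norm_eq_abs]
    refine norm_integral_le_of_norm_le ((integrableOn_szaszZ_mul_exp n _ hA).const_mul _) ?_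
    filter_upwards [ae_restrict_mem measurableSet_Ioi] with t ht
    rw [norm_mul, Real.norm_of_nonneg (szaszZ_nonneg n _ (le_of_lt ht)), Real.norm_eq_abs]
    have := mul_le_mul_of_nonneg_left ((hK t ht).trans
      (mul_le_mul_of_nonneg_right (le_abs_self K) (exp_pos _).le))
      (szaszZ_nonneg n (k - j) (le_of_lt ht))
    linarith
  rw [integral_const_mul] at h1
  rw [abs_mul, abs_of_pos hn]
  calc _ ≤ (n : ℝ) * (|K| * ∫ t in Set.Ioi (0 : ℝ), szaszZ n (k - j) t * exp (A * t)) := by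
        gcongr
    _ = |K| * (n * ∫ t in Set.Ioi (0 : ℝ), szaszZ n (k - j) t * exp (A * t)) := by ring
    _ ≤ |K| * (n / (n - A)) ^ ((k : ℤ) - j + 1) := by
        gcongr
        exact integral_szaszZ_mul_exp_le _ hA0 hA
    _ = _ := by
        rw [mul_assoc, ← zpow_natCast, ← zpow_add₀ hρ.ne']
        congr 2
        ring

lemma hasSum_szasz_mul_pow (n : ℕ) (x ρ : ℝ) :
    HasSum (fun k => szasz n k x * ρ ^ k) (exp (-(n : ℝ) * x + n * x * ρ)) := by
  have h := (NormedSpace.expSeries_div_hasSum_exp (𝔸 := ℝ) (n * x * ρ)).mul_left (exp (-(n : ℝ) * x))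
  rw [← congr_fun Real.exp_eq_exp_ℝ, ← exp_add] at h
  refine (funext fun k => ?_ : (fun k => szasz n k x * ρ ^ k) = _) ▸ h
  rw [szasz, mul_pow _ ρ]
  ring

lemma summable_szasz_mul (n : ℕ) (y : ℝ) {a : ℕ → ℝ} {C ρ : ℝ}
    (ha : ∀ k, |a k| ≤ C * ρ ^ k) : Summable fun k => szasz n k y * a k := by
  have h := (hasSum_szasz_mul_pow n |y| ρ).summable.mul_left
    (C * exp (-(n : ℝ) * y - (-(n : ℝ) * |y|)))
  refine Summable.of_norm_bounded h fun k => ?_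
  have h1 : |szasz n k y| = exp (-(n : ℝ) * y - (-(n : ℝ) * |y|)) * szasz n k |y| := by
    rw [szasz, szasz, exp_sub, abs_div, abs_mul, abs_pow, abs_mul, Nat.abs_cast, Nat.abs_cast,
      abs_of_pos (exp_pos _)]
    field_simp
  rw [Real.norm_eq_abs, abs_mul, h1]
  calc _ ≤ exp (-(n : ℝ) * y - (-(n : ℝ) * |y|)) * szasz n k |y| * (C * ρ ^ k) :=
        mul_le_mul_of_nonneg_left (ha k)
          (mul_nonneg (exp_pos _).le (szasz_nonneg n k (abs_nonneg y)))
    _ = _ := by ring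

lemma hasDerivAt_tsum_pow_div_factorial {a : ℕ → ℝ} {C ρ : ℝ} (ha : ∀ k, |a k| ≤ C * ρ ^ k)
    (z : ℝ) : HasDerivAt (fun z => ∑' k : ℕ, z ^ k / (k.factorial : ℝ) * a k)
      (∑' k : ℕ, z ^ k / (k.factorial : ℝ) * a (k + 1)) z := by
  set R := |z| + 1 with hR
  have hexp (w c : ℝ) : Summable fun k : ℕ => c * (w ^ k / (k.factorial : ℝ)) :=
    (Real.summable_pow_div_factorial w).mul_left c
  have hsucc (k : ℕ) (w : ℝ) : ((k + 1 : ℕ) : ℝ) * w ^ k / ((k + 1).factorial : ℝ) =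
      w ^ k / (k.factorial : ℝ) := by
    rw [Nat.factorial_succ]
    push_cast
    field_simp
  have hu : Summable fun k : ℕ => (k : ℝ) * R ^ (k - 1) / (k.factorial : ℝ) * (C * ρ ^ k) := by
    rw [← summable_nat_add_iff 1]
    refine (hexp (R * ρ) (C * ρ)).congr fun k => ?_
    rw [Nat.add_sub_cancel, hsucc, mul_pow, pow_succ]
    ring
  have hmem : z ∈ Metric.ball (0 : ℝ) R := by simp [hR]
  have h := hasDerivAt_tsum_of_isPreconnected (𝕜 := ℝ) (y₀ := z) (y := z)
    (g := fun k z => z ^ k / (k.factorial : ℝ) * a k)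
    (g' := fun k z => (k : ℝ) * z ^ (k - 1) / (k.factorial : ℝ) * a k) hu Metric.isOpen_ball
    (convex_ball (0 : ℝ) R).isPreconnected
    (fun k y _ => ((hasDerivAt_pow k y).div_const _).mul_const _) ?_ hmem ?_ hmem
  · refine h.congr_deriv ?_
    have hs : Summable fun k : ℕ => (k : ℝ) * z ^ (k - 1) / (k.factorial : ℝ) * a k := by
      refine Summable.of_norm_bounded hu fun k => ?_
      rw [norm_mul, norm_div, norm_mul, norm_pow, Real.norm_eq_abs, Real.norm_eq_abs z,
        Real.norm_eq_abs (a k), Real.norm_eq_abs, Nat.abs_cast, Nat.abs_cast]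
      refine mul_le_mul ?_ (ha k) (abs_nonneg _) (by positivity)
      gcongr
      linarith
    rw [hs.tsum_eq_zero_add]
    simp only [CharP.cast_eq_zero, zero_mul, zero_div, zero_add, Nat.add_sub_cancel]
    exact tsum_congr fun k => by rw [hsucc]
  · intro k y hy
    have hy' : |y| ≤ R := by simpa using (mem_ball_zero_iff.1 hy).le
    rw [norm_mul, norm_div, norm_mul, norm_pow, Real.norm_eq_abs, Real.norm_eq_abs y,
      Real.norm_eq_abs (a k), Real.norm_eq_abs, Nat.abs_cast, Nat.abs_cast]
    refine mul_le_mul ?_ (ha k) (abs_nonneg _) (by positivity)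
    gcongr
  · refine Summable.of_norm_bounded (hexp (|z| * ρ) C) fun k => ?_
    rw [norm_mul, norm_div, norm_pow, Real.norm_eq_abs, Real.norm_eq_abs (a k), Real.norm_eq_abs,
      Nat.abs_cast]
    calc _ ≤ |z| ^ k / (k.factorial : ℝ) * (C * ρ ^ k) :=
          mul_le_mul_of_nonneg_left (ha k) (by positivity)
      _ = _ := by rw [mul_pow]; ring

lemma hasDerivAt_tsum_szasz_mul (n : ℕ) {a : ℕ → ℝ} {C ρ : ℝ} (ha : ∀ k, |a k| ≤ C * ρ ^ k)
    (y : ℝ) : HasDerivAt (fun y => ∑' k, szasz n k y * a k)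
      (n * (∑' k, szasz n k y * a (k + 1) - ∑' k, szasz n k y * a k)) y := by
  have he (b : ℕ → ℝ) (y : ℝ) : ∑' k, szasz n k y * b k =
      exp (-(n : ℝ) * y) * ∑' k : ℕ, (n * y) ^ k / (k.factorial : ℝ) * b k := by
    rw [← tsum_mul_left]
    exact tsum_congr fun k => by rw [szasz]; ring
  simp only [he]
  have h1 : HasDerivAt (fun y : ℝ => -(n : ℝ) * y) (-(n : ℝ)) y := by
    simpa using (hasDerivAt_id y).const_mul (-(n : ℝ))
  have h2 : HasDerivAt (fun y : ℝ => (n : ℝ) * y) n y := by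
    simpa using (hasDerivAt_id y).const_mul (n : ℝ)
  refine (h1.exp.mul ((hasDerivAt_tsum_pow_div_factorial ha (n * y)).comp y h2)).congr_deriv ?_
  simp only [Function.comp]
  ring

lemma hasDerivAt_sum_range_szasz (n k : ℕ) (y : ℝ) :
    HasDerivAt (fun y => ∑ i ∈ Finset.range k, szasz n i y)
      (n * (∑ i ∈ Finset.range (k - 1), szasz n i y - ∑ i ∈ Finset.range k, szasz n i y)) y := by
  have h := hasDerivAt_tsum_szasz_mul n (a := fun i => if i < k then 1 else 0) (C := 1) (ρ := 1)
    (fun i => by split_ifs <;> simp) y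
  have he (l : ℕ) (y : ℝ) : ∑' i, szasz n i y * (if i < l then 1 else 0) =
      ∑ i ∈ Finset.range l, szasz n i y := by
    rw [tsum_eq_sum (s := Finset.range l)]
    · exact Finset.sum_congr rfl fun i hi => by simp [Finset.mem_range.1 hi]
    · intro i hi
      simp [Finset.mem_range.not.1 hi]
  have he' : ∑' i, szasz n i y * (if i + 1 < k then 1 else 0) =
      ∑ i ∈ Finset.range (k - 1), szasz n i y := by
    rw [← he]
    exact tsum_congr fun i => by simp only [Nat.lt_sub_iff_add_lt]
  simpa only [he, he'] using h

/-- The part of `S_{n,j}` that does not involve the value of the function at `0`. -/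
noncomputable def szaszTail (n : ℕ) (j : ℤ) (g : ℝ → ℝ) (x : ℝ) : ℝ :=
  ∑' k : ℕ, szasz n k x * (n * ∫ t in Set.Ioi (0 : ℝ), szaszZ n (k - j) t * g t)

lemma Sop_eq (n : ℕ) (j : ℤ) (f : ℝ → ℝ) (x : ℝ) :
    Sop n j f x = f 0 * ∑ k ∈ Finset.range j.toNat, szasz n k x + szaszTail n j f x := rfl

lemma hasDerivAt_Sop {A : ℝ} {f : ℝ → ℝ} (hf : ExpBounded A f) (hA0 : 0 ≤ A) {n : ℕ}
    (hA : A < n) (j : ℤ) (y : ℝ) :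
    HasDerivAt (Sop n j f) (n * (Sop n (j - 1) f y - Sop n j f y)) y := by
  obtain ⟨C, ρ, -, -, h⟩ := hf.exists_integral_le hA0 hA j
  have h1 := (hasDerivAt_sum_range_szasz n j.toNat y).const_mul (f 0)
  have h2 := h1.add (hasDerivAt_tsum_szasz_mul n h y)
  refine h2.congr_deriv ?_
  have hs : ∑' k : ℕ, szasz n k y * (n * ∫ t in Set.Ioi (0 : ℝ),
      szaszZ n ((k + 1 : ℕ) - j) t * f t) = szaszTail n (j - 1) f y := by
    refine tsum_congr fun k => ?_
    rw [show ((k + 1 : ℕ) : ℤ) - j = k - (j - 1) by push_cast; ring]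
  rw [hs, Sop_eq, Sop_eq, show (j - 1).toNat = j.toNat - 1 by omega, szaszTail, szaszTail]
  ring

lemma contDiff_Sop {A : ℝ} {f : ℝ → ℝ} (hf : ExpBounded A f) (hA0 : 0 ≤ A) {n : ℕ}
    (hA : A < n) (m : ℕ) : ∀ j : ℤ, ContDiff ℝ m (Sop n j f) := by
  have hd (j : ℤ) := hasDerivAt_Sop hf hA0 hA j
  induction m with
  | zero => exact fun j => contDiff_zero.2 (continuous_iff_continuousAt.2
      fun y => (hd j y).continuousAt)
  | succ m ih =>
    intro j
    rw [Nat.cast_succ, contDiff_succ_iff_deriv]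
    refine ⟨fun y => (hd j y).differentiableAt, by simp, ?_⟩
    rw [funext fun y => (hd j y).deriv]
    exact contDiff_const.mul ((ih (j - 1)).sub (ih j))

lemma iteratedDeriv_succ_Sop {A : ℝ} {f : ℝ → ℝ} (hf : ExpBounded A f) (hA0 : 0 ≤ A) {n : ℕ}
    (hA : A < n) (m : ℕ) (j : ℤ) (x : ℝ) :
    iteratedDeriv (m + 1) (Sop n j f) x =
      n * (iteratedDeriv m (Sop n (j - 1) f) x - iteratedDeriv m (Sop n j f) x) := by
  rw [iteratedDeriv_succ', funext fun y => (hasDerivAt_Sop hf hA0 hA j y).deriv,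
    iteratedDeriv_const_mul_field]
  congr 1
  exact iteratedDeriv_sub (contDiff_Sop hf hA0 hA m _).contDiffAt
    (contDiff_Sop hf hA0 hA m _).contDiffAt

lemma ExpBounded.summable_szaszTail {A : ℝ} {g : ℝ → ℝ} (hg : ExpBounded A g) (hA0 : 0 ≤ A)
    {n : ℕ} (hA : A < n) (j : ℤ) (x : ℝ) : Summable fun k : ℕ =>
      szasz n k x * (n * ∫ t in Set.Ioi (0 : ℝ), szaszZ n (k - j) t * g t) := by
  obtain ⟨C, ρ, -, -, h⟩ := hg.exists_integral_le hA0 hA j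
  exact summable_szasz_mul n x h

lemma szaszTail_add {A : ℝ} {g h : ℝ → ℝ} (hg : ExpBounded A g) (hh : ExpBounded A h)
    (hA0 : 0 ≤ A) {n : ℕ} (hA : A < n) (j : ℤ) (x : ℝ) :
    szaszTail n j (fun t => g t + h t) x = szaszTail n j g x + szaszTail n j h x := by
  unfold szaszTail
  rw [← (hg.summable_szaszTail hA0 hA j x).tsum_add (hh.summable_szaszTail hA0 hA j x)]
  refine tsum_congr fun k => ?_
  simp only [mul_add]
  rw [integral_add (hg.integrableOn_szaszZ_mul hA _) (hh.integrableOn_szaszZ_mul hA _)]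
  ring

lemma szaszTail_const_mul (n : ℕ) (j : ℤ) (c : ℝ) (g : ℝ → ℝ) (x : ℝ) :
    szaszTail n j (fun t => c * g t) x = c * szaszTail n j g x := by
  unfold szaszTail
  rw [← tsum_mul_left]
  refine tsum_congr fun k => ?_
  simp only [mul_left_comm _ c]
  rw [integral_const_mul]
  ring

lemma abs_szaszTail_le {A : ℝ} {g h : ℝ → ℝ} (hh : ExpBounded A h)
    (hA0 : 0 ≤ A) {n : ℕ} (hA : A < n) (j : ℤ) {x : ℝ} (hx : 0 ≤ x)
    (hgh : ∀ t > 0, |g t| ≤ h t) : |szaszTail n j g x| ≤ szaszTail n j h x := by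
  rw [← Real.norm_eq_abs, szaszTail]
  refine tsum_of_norm_bounded (hh.summable_szaszTail hA0 hA j x).hasSum fun k => ?_
  rw [norm_mul, norm_mul, Real.norm_of_nonneg (szasz_nonneg n k hx),
    Real.norm_of_nonneg n.cast_nonneg]
  refine mul_le_mul_of_nonneg_left (mul_le_mul_of_nonneg_left ?_ n.cast_nonneg)
    (szasz_nonneg n k hx)
  refine norm_integral_le_of_norm_le (hh.integrableOn_szaszZ_mul hA _) ?_
  filter_upwards [ae_restrict_mem measurableSet_Ioi] with t ht
  rw [norm_mul, Real.norm_of_nonneg (szaszZ_nonneg n _ (le_of_lt ht))]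
  exact mul_le_mul_of_nonneg_left (hgh t ht) (szaszZ_nonneg n _ (le_of_lt ht))

lemma szaszTail_exp_le {A : ℝ} (hA0 : 0 ≤ A) {n : ℕ} (hA : A < n) (j : ℤ) {x : ℝ} (hx : 0 ≤ x) :
    szaszTail n j (fun t => exp (A * t)) x ≤
      (n / (n - A)) ^ (1 - j) * exp (A * x * (n / (n - A))) := by
  have hr : 0 < n - A := sub_pos.2 hA
  have hn : (0 : ℝ) < n := hA0.trans_lt hA
  have hρ : 0 < n / (n - A) := by positivity
  have h := (hasSum_szasz_mul_pow n x (n / (n - A))).mul_left ((n / (n - A)) ^ (1 - j))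
  rw [show -(n : ℝ) * x + n * x * (n / (n - A)) = A * x * (n / (n - A)) by field_simp; ring] at h
  refine hasSum_le (fun k => ?_)
    ((expBounded_exp A).summable_szaszTail hA0 hA j x).hasSum h
  calc _ ≤ szasz n k x * (n / (n - A)) ^ ((k : ℤ) - j + 1) :=
        mul_le_mul_of_nonneg_left (integral_szaszZ_mul_exp_le _ hA0 hA) (szasz_nonneg n k hx)
    _ = _ := by
        rw [mul_left_comm, ← zpow_natCast, ← zpow_add₀ hρ.ne']
        congr 2
        ring

lemma exists_szaszTail_exp_le {A : ℝ} (hA0 : 0 ≤ A) (j : ℤ) {x : ℝ} (hx : 0 ≤ x) :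
    ∃ C, ∀ᶠ n : ℕ in atTop, szaszTail n j (fun t => exp (A * t)) x ≤ C := by
  have hlim : Tendsto (fun n : ℕ => (n : ℝ) / (n - A)) atTop (nhds 1) := by
    simpa [sub_eq_add_neg] using tendsto_natCast_div_add_atTop (-A)
  have h2 : Tendsto (fun n : ℕ => ((n : ℝ) / (n - A)) ^ (1 - j) *
      exp (A * x * (n / (n - A)))) atTop (nhds ((1 : ℝ) ^ (1 - j) * exp (A * x * 1))) :=
    (hlim.zpow₀ _ (Or.inl one_ne_zero)).mul
      (Real.continuous_exp.continuousAt.tendsto.comp (hlim.const_mul (A * x)))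
  refine ⟨(1 : ℝ) ^ (1 - j) * exp (A * x * 1) + 1, ?_⟩
  filter_upwards [h2.eventually (gt_mem_nhds (lt_add_one _)),
    (tendsto_natCast_atTop_atTop (R := ℝ)).eventually_gt_atTop A] with n hn hA
  exact (szaszTail_exp_le hA0 hA j hx).trans hn.le

lemma tendsto_pow_mul_szasz {x : ℝ} (hx : 0 < x) (M k : ℕ) :
    Tendsto (fun n : ℕ => (n : ℝ) ^ M * szasz n k x) atTop (nhds 0) := by
  have h := ((tendsto_pow_mul_exp_neg_atTop_nhds_zero (M + k)).comp
    (tendsto_natCast_atTop_atTop.atTop_mul_const hx)).mul_const (1 / (x ^ M * k.factorial))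
  rw [zero_mul] at h
  refine h.congr fun n => ?_
  simp only [Function.comp, szasz]
  rw [show -((n : ℝ) * x) = -(n : ℝ) * x by ring, pow_add, mul_pow, mul_pow]
  field_simp

lemma tendsto_pow_mul_sum_szasz {x : ℝ} (hx : 0 < x) (M l : ℕ) (b : ℕ → ℝ) :
    Tendsto (fun n : ℕ => (n : ℝ) ^ M * ∑ k ∈ Finset.range l, szasz n k x * b k)
      atTop (nhds 0) := by
  have h := tendsto_finsetSum (Finset.range l) fun k _ =>
    (tendsto_pow_mul_szasz hx M k).mul_const (b k)
  simp only [zero_mul, Finset.sum_const_zero] at h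
  refine h.congr fun n => ?_
  rw [Finset.mul_sum]
  exact Finset.sum_congr rfl fun k _ => by ring

lemma integral_szasz_mul_pow {n : ℕ} (hn : 0 < n) (l r : ℕ) :
    n * ∫ t in Set.Ioi (0 : ℝ), szasz n l t * t ^ r =
      r.factorial / n ^ r * (Ring.choose ((l : ℤ) + r) r : ℤ) := by
  have hn' : (0 : ℝ) < n := by exact_mod_cast hn
  have he : (fun t => szasz n l t * t ^ r) =
      fun t => ((n : ℝ) ^ l / l.factorial) * (t ^ (l + r) * exp (-(n * t))) := by
    funext t
    rw [show -(n * t) = -(n : ℝ) * t by ring, szasz]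
    ring
  rw [he, integral_const_mul, (integral_pow_mul_exp_neg_mul (l + r) hn').2,
    ← Nat.cast_add, Ring.choose_natCast, ← Nat.add_choose_mul_factorial_mul_factorial l r]
  push_cast
  field_simp
  ring

lemma hasSum_szasz_mul_choose (n i : ℕ) (x : ℝ) :
    HasSum (fun k => szasz n k x * (k.choose i : ℝ)) ((n * x) ^ i / i.factorial) := by
  rw [← hasSum_nat_add_iff' i, Finset.sum_eq_zero, sub_zero]
  · have h := (hasSum_szasz_mul_pow n x 1).mul_left ((n * x) ^ i / i.factorial)
    rw [mul_one, neg_mul, neg_add_cancel, exp_zero, mul_one] at h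
    refine (funext fun k => ?_ : (fun k => szasz n (k + i) x * ((k + i).choose i : ℝ)) = _) ▸ h
    rw [szasz, szasz, ← Nat.add_choose_mul_factorial_mul_factorial k i]
    have : (0 : ℝ) < (k + i).choose i := by exact_mod_cast Nat.choose_pos (by omega)
    push_cast
    field_simp
    ring
  · intro k hk
    rw [Nat.choose_eq_zero_of_lt (Finset.mem_range.1 hk)]
    simp

lemma hasSum_szasz_mul_ringChoose (n r : ℕ) (a : ℤ) (x : ℝ) :
    HasSum (fun k : ℕ => szasz n k x * (Ring.choose ((k : ℤ) + a) r : ℤ))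
      (∑ l ∈ Finset.range (r + 1), (n * x) ^ (r - l) / (r - l).factorial * (Ring.choose a l : ℤ)) := by
  have h := hasSum_sum (s := Finset.range (r + 1)) fun l _ =>
    (hasSum_szasz_mul_choose n (r - l) x).mul_right ((Ring.choose a l : ℤ) : ℝ)
  refine (funext fun k => ?_ :
    (fun k : ℕ => szasz n k x * (Ring.choose ((k : ℤ) + a) r : ℤ)) = _) ▸ h
  rw [add_comm, Ring.add_choose_eq r (Commute.all a (k : ℤ)),
    Finset.Nat.sum_antidiagonal_eq_sum_range_succ_mk]
  push_cast
  rw [Finset.mul_sum]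
  refine Finset.sum_congr rfl fun l _ => ?_
  rw [Ring.choose_natCast]
  push_cast
  ring

lemma szaszTail_pow {n : ℕ} (hn : 0 < n) (j : ℤ) (r : ℕ) (x : ℝ) :
    szaszTail n j (fun t => t ^ r) x =
      ∑ k ∈ Finset.range (r + 1), 1 / (n : ℝ) ^ k *
        szaszCoeff j x (fun l => (r.descFactorial l : ℝ) * x ^ (r - l)) k -
      r.factorial / n ^ r * ∑ k ∈ Finset.range j.toNat,
        szasz n k x * (Ring.choose ((k : ℤ) + (r - j)) r : ℤ) := by
  have hn' : (0 : ℝ) < n := by exact_mod_cast hn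
  have h := hasSum_szasz_mul_ringChoose n r (r - j) x
  have hsub : HasSum (fun k : ℕ => if k < j.toNat then
      szasz n k x * ((Ring.choose ((k : ℤ) + (r - j)) r : ℤ) : ℝ) else 0) _ :=
    hasSum_sum_of_ne_finset_zero (s := Finset.range j.toNat)
      fun k hk => if_neg (Finset.mem_range.not.1 hk)
  have h2 := (h.sub hsub).mul_left ((r.factorial : ℝ) / n ^ r)
  have h3 : szaszTail n j (fun t => t ^ r) x = _ := (tsum_congr fun k => ?_).trans h2.tsum_eq
  · rw [h3, mul_sub, Finset.mul_sum]
    congr 1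
    · refine Finset.sum_congr rfl fun k hk => ?_
      have hk' : k ≤ r := by simpa [Nat.lt_succ_iff] using hk
      rw [szaszCoeff_pow, mul_pow]
      have h4 : (r.factorial : ℝ) = (r - k).factorial * r.descFactorial k := by
        exact_mod_cast (Nat.factorial_mul_descFactorial hk').symm
      have h5 : (n : ℝ) ^ r = n ^ (r - k) * n ^ k := by rw [← pow_add]; congr 1; omega
      rw [h4, h5]
      field_simp
    · congr 1
      exact Finset.sum_congr rfl fun k hk => if_pos (Finset.mem_range.1 hk)
  · by_cases hk : k < j.toNat
    · rw [if_pos hk, sub_self, mul_zero]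
      have : ¬ (0 : ℤ) ≤ k - j := by omega
      simp only [szaszZ, this, if_false, zero_mul, integral_zero, mul_zero]
    · rw [if_neg hk, sub_zero]
      obtain ⟨l, hl⟩ : ∃ l : ℕ, (k : ℤ) - j = l := ⟨((k : ℤ) - j).toNat, by omega⟩
      have := integral_szasz_mul_pow hn l r
      simp only [hl, szaszZ, Int.natCast_nonneg, if_true, Int.toNat_natCast]
      rw [this, show (k : ℤ) + (r - j) = l + r by omega]
      ring

/-- `S_{n,j} g` has at `x` the complete asymptotic expansion whose coefficients are computed from
the numbers `D l`, up to the contribution of the value of `g` at `0`. -/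
def HasSzaszExpansion (j : ℤ) (x : ℝ) (g : ℝ → ℝ) (D : ℕ → ℝ) : Prop :=
  ∀ M : ℕ, Tendsto (fun n : ℕ => (n : ℝ) ^ M * (szaszTail n j g x -
    ∑ k ∈ Finset.range (M + 1), 1 / (n : ℝ) ^ k * szaszCoeff j x D k)) atTop (nhds 0)

lemma hasSzaszExpansion_pow (j : ℤ) {x : ℝ} (hx : 0 < x) (r : ℕ) :
    HasSzaszExpansion j x (fun t => t ^ r)
      (fun l => (r.descFactorial l : ℝ) * x ^ (r - l)) := by
  intro M
  set c : ℕ → ℝ := szaszCoeff j x (fun l => (r.descFactorial l : ℝ) * x ^ (r - l)) with hc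
  have hc0 (k : ℕ) (hk : r < k) : c k = 0 := by
    rw [hc, szaszCoeff_pow, Nat.descFactorial_of_lt hk]
    simp
  have h1 : Tendsto (fun n : ℕ => ∑ i ∈ Finset.range r, 1 / (n : ℝ) ^ (i + 1) * c (M + 1 + i))
      atTop (nhds 0) := by
    have h := tendsto_finsetSum (Finset.range r) fun i _ =>
      (((tendsto_pow_atTop (α := ℝ) (Nat.succ_ne_zero i)).comp
        tendsto_natCast_atTop_atTop).inv_tendsto_atTop).mul_const (c (M + 1 + i))
    simpa using h
  have h2 := (tendsto_pow_mul_sum_szasz hx M j.toNat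
    (fun k => r.factorial * ((Ring.choose ((k : ℤ) + (r - j)) r : ℤ) : ℝ)))
  have h3 : Tendsto (fun n : ℕ => 1 / (n : ℝ) ^ r * ((n : ℝ) ^ M *
      ∑ k ∈ Finset.range j.toNat, szasz n k x *
        (r.factorial * ((Ring.choose ((k : ℤ) + (r - j)) r : ℤ) : ℝ)))) atTop (nhds 0) := by
    refine squeeze_zero_norm' ?_ (tendsto_zero_iff_norm_tendsto_zero.1 h2)
    filter_upwards [eventually_ge_atTop 1] with n hn
    rw [norm_mul]
    refine mul_le_of_le_one_left (norm_nonneg _) ?_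
    have : (1 : ℝ) ≤ (n : ℝ) ^ r := one_le_pow₀ (by exact_mod_cast hn)
    rw [Real.norm_of_nonneg (by positivity)]
    exact div_le_one_of_le₀ this (by positivity)
  have h4 := h1.sub h3
  rw [sub_zero] at h4
  refine h4.congr' ?_
  filter_upwards [eventually_ge_atTop 1] with n hn
  have hn' : (0 : ℝ) < n := by exact_mod_cast hn
  have hext : ∑ k ∈ Finset.range (r + 1), 1 / (n : ℝ) ^ k * c k =
      ∑ k ∈ Finset.range (M + 1 + r), 1 / (n : ℝ) ^ k * c k := by
    refine Finset.sum_subset (Finset.range_subset_range.2 (by omega)) fun k _ hk => ?_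
    rw [hc0 k (by simpa using hk), mul_zero]
  rw [szaszTail_pow hn, hext, Finset.sum_range_add, add_sub_assoc, add_sub_cancel_left, mul_sub]
  congr 1
  · rw [Finset.mul_sum]
    refine Finset.sum_congr rfl fun i _ => ?_
    rw [show M + 1 + i = M + (i + 1) by omega, pow_add]
    field_simp
    ring
  · simp only [Finset.mul_sum]
    exact Finset.sum_congr rfl fun k _ => by ring

lemma HasSzaszExpansion.add {j : ℤ} {x A : ℝ} {g h : ℝ → ℝ} {D E : ℕ → ℝ} (hA0 : 0 ≤ A)
    (hg : ExpBounded A g) (hh : ExpBounded A h)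
    (hgD : HasSzaszExpansion j x g D) (hhE : HasSzaszExpansion j x h E) :
    HasSzaszExpansion j x (fun t => g t + h t) (fun l => D l + E l) := by
  intro M
  have h1 := (hgD M).add (hhE M)
  rw [add_zero] at h1
  refine h1.congr' ?_
  filter_upwards [(tendsto_natCast_atTop_atTop (R := ℝ)).eventually_gt_atTop A] with n hA
  rw [szaszTail_add hg hh hA0 hA]
  simp only [szaszCoeff_add, mul_add, Finset.sum_add_distrib]
  ring

lemma HasSzaszExpansion.const_mul {j : ℤ} {x : ℝ} {g : ℝ → ℝ} {D : ℕ → ℝ}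
    (hgD : HasSzaszExpansion j x g D) (c : ℝ) :
    HasSzaszExpansion j x (fun t => c * g t) (fun l => c * D l) := by
  intro M
  have h1 := (hgD M).const_mul c
  rw [mul_zero] at h1
  refine h1.congr fun n => ?_
  simp only [szaszTail_const_mul, szaszCoeff_const_mul, mul_left_comm _ c, ← Finset.mul_sum]
  ring

lemma hasSzaszExpansion_polynomial (j : ℤ) {x : ℝ} (hx : 0 < x) (P : Polynomial ℝ) :
    HasSzaszExpansion j x (fun t => P.eval t)
      (fun l => (Polynomial.derivative^[l] P).eval x) := by
  induction P using Polynomial.induction_on' with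
  | add p q hp hq =>
    simpa [iterate_map_add] using
      hp.add zero_le_one (ExpBounded.polynomial p) (ExpBounded.polynomial q) hq
  | monomial r a =>
    have h := (hasSzaszExpansion_pow j hx r).const_mul a
    rw [← Polynomial.C_mul_X_pow_eq_monomial]
    simpa [Polynomial.iterate_derivative_C_mul, Polynomial.iterate_derivative_X_pow_eq_C_mul]
      using h

/-- The Taylor polynomial of degree `N` of `g` at `x`. -/
noncomputable def taylorPoly (g : ℝ → ℝ) (x : ℝ) (N : ℕ) : Polynomial ℝ :=
  ∑ l ∈ Finset.range (N + 1), Polynomial.C (iteratedDeriv l g x / (l.factorial : ℝ)) *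
    (Polynomial.X - Polynomial.C x) ^ l

lemma eval_iterate_derivative_X_sub_C_pow (x : ℝ) (l k : ℕ) :
    (Polynomial.derivative^[k] ((Polynomial.X - Polynomial.C x) ^ l)).eval x =
      if l = k then (l.factorial : ℝ) else 0 := by
  rw [Polynomial.iterate_derivative_X_sub_pow]
  rcases lt_trichotomy l k with h | h | h
  · simp [Nat.descFactorial_of_lt h, h.ne]
  · simp [h, Nat.descFactorial_self]
  · simp [h.ne', zero_pow (Nat.sub_ne_zero_of_lt h)]

lemma eval_iterate_derivative_taylorPoly (g : ℝ → ℝ) (x : ℝ) {N k : ℕ} (hk : k ≤ N) :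
    (Polynomial.derivative^[k] (taylorPoly g x N)).eval x = iteratedDeriv k g x := by
  rw [taylorPoly, Polynomial.iterate_derivative_sum, Polynomial.eval_finsetSum,
    Finset.sum_eq_single k]
  · rw [Polynomial.iterate_derivative_C_mul, Polynomial.eval_mul, Polynomial.eval_C,
      eval_iterate_derivative_X_sub_C_pow, if_pos rfl]
    field_simp
  · intro l _ hl
    rw [Polynomial.iterate_derivative_C_mul, Polynomial.eval_mul,
      eval_iterate_derivative_X_sub_C_pow, if_neg hl, mul_zero]
  · intro h
    exact absurd (Finset.mem_range.2 (by omega)) h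

lemma derivative_taylorPoly_succ (g : ℝ → ℝ) (x : ℝ) (N : ℕ) :
    Polynomial.derivative (taylorPoly g x (N + 1)) = taylorPoly (deriv g) x N := by
  rw [taylorPoly, taylorPoly, Finset.sum_range_succ']
  simp only [Polynomial.derivative_add, Polynomial.derivative_sum, pow_zero, mul_one,
    Polynomial.derivative_C, add_zero]
  refine Finset.sum_congr rfl fun l _ => ?_
  rw [Polynomial.derivative_C_mul, Polynomial.derivative_X_sub_C_pow, Nat.add_sub_cancel,
    iteratedDeriv_succ', ← mul_assoc, ← Polynomial.C_mul, Nat.factorial_succ]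
  congr 2
  push_cast
  field_simp

lemma eval_taylorPoly_self (g : ℝ → ℝ) (x : ℝ) (N : ℕ) : (taylorPoly g x N).eval x = g x := by
  simpa using eval_iterate_derivative_taylorPoly g x (Nat.zero_le N)

/-- If `h x = 0` and the derivative of `h` is `o((t - x) ^ N)` at `x`, then `h` is
`o((t - x) ^ (N + 1))`. -/
lemma isLittleO_pow_succ_of_deriv {h h' : ℝ → ℝ} {x : ℝ} {N : ℕ} (h0 : h x = 0)
    (hd : ∀ᶠ y in nhds x, HasDerivAt h (h' y) y)
    (ho : h' =o[nhds x] fun t => (t - x) ^ N) : h =o[nhds x] fun t => (t - x) ^ (N + 1) := by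
  rw [Asymptotics.isLittleO_iff] at ho ⊢
  intro c hc
  obtain ⟨δ, hδ, hball⟩ := Metric.eventually_nhds_iff_ball.1 (hd.and (ho hc))
  refine Metric.eventually_nhds_iff_ball.2 ⟨δ, hδ, fun t ht => ?_⟩
  have hsub : Metric.closedBall x |t - x| ⊆ Metric.ball x δ :=
    Metric.closedBall_subset_ball (by simpa [Real.dist_eq] using ht)
  have hmv := (convex_closedBall x |t - x|).norm_image_sub_le_of_norm_hasDerivWithin_le
    (f := h) (f' := h') (C := c * |t - x| ^ N) (x := x) (y := t)
    (fun y hy => (hball y (hsub hy)).1.hasDerivWithinAt) (fun y hy => ?_)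
    (Metric.mem_closedBall_self (abs_nonneg _)) (by simp [Real.dist_eq])
  · rw [h0, sub_zero] at hmv
    rw [norm_pow, pow_succ, Real.norm_eq_abs (t - x), ← mul_assoc]
    exact hmv
  · refine ((hball y (hsub hy)).2).trans ?_
    rw [norm_pow, Real.norm_eq_abs (y - x)]
    exact mul_le_mul_of_nonneg_left (pow_le_pow_left₀ (abs_nonneg _)
      (by simpa [Real.dist_eq] using Metric.mem_closedBall.1 hy) N) hc.le

/-- Taylor's theorem with Peano remainder. -/
lemma sub_taylorPoly_isLittleO (N : ℕ) : ∀ {g : ℝ → ℝ} {x : ℝ},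
    (∀ i < N, ∀ᶠ y in nhds x, DifferentiableAt ℝ (iteratedDeriv i g) y) →
    DifferentiableAt ℝ (iteratedDeriv N g) x →
    (fun t => g t - (taylorPoly g x (N + 1)).eval t) =o[nhds x] fun t => (t - x) ^ (N + 1) := by
  induction N with
  | zero =>
    intro g x _ hg
    rw [iteratedDeriv_zero] at hg
    have := hasDerivAt_iff_isLittleO.1 hg.hasDerivAt
    refine (this.congr_left fun t => ?_).congr_right fun t => ?_
    · simp [taylorPoly, Finset.sum_range_succ]
      ring
    · simp
  | succ N ih =>
    intro g x hg hx
    refine isLittleO_pow_succ_of_deriv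
      (h' := fun t => deriv g t - (taylorPoly (deriv g) x (N + 1)).eval t) ?_ ?_
      (ih (fun i hi => ?_) ?_)
    · rw [eval_taylorPoly_self, sub_self]
    · filter_upwards [hg 0 (Nat.succ_pos N)] with y hy
      rw [iteratedDeriv_zero] at hy
      rw [← derivative_taylorPoly_succ]
      exact hy.hasDerivAt.sub (Polynomial.hasDerivAt _ _)
    · simpa only [iteratedDeriv_succ'] using hg (i + 1) (by omega)
    · simpa only [iteratedDeriv_succ'] using hx

lemma exists_pow_mul_szaszTail_sub_pow_le (j : ℤ) {x : ℝ} (hx : 0 < x) (M : ℕ) :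
    ∃ C, ∀ᶠ n : ℕ in atTop, (n : ℝ) ^ M * szaszTail n j (fun t => (t - x) ^ (2 * M)) x ≤ C := by
  have h := hasSzaszExpansion_polynomial j hx ((Polynomial.X - Polynomial.C x) ^ (2 * M)) M
  simp only [eval_iterate_derivative_X_sub_C_pow, Polynomial.eval_pow, Polynomial.eval_sub,
    Polynomial.eval_X, Polynomial.eval_C] at h
  set D : ℕ → ℝ := fun l => if 2 * M = l then ((2 * M).factorial : ℝ) else 0 with hD
  have hc (k : ℕ) (hk : k < M) : szaszCoeff j x D k = 0 := by
    refine Finset.sum_eq_zero fun i hi => ?_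
    have := Finset.mem_range.1 hi
    rw [hD]
    simp only
    rw [if_neg (by omega), mul_zero]
  refine ⟨szaszCoeff j x D M + 1, ?_⟩
  filter_upwards [h.eventually (gt_mem_nhds zero_lt_one), eventually_ge_atTop 1] with n hn h1
  have hn' : (0 : ℝ) < n := by exact_mod_cast h1
  rw [Finset.sum_range_succ, Finset.sum_eq_zero (fun k hk => by
    rw [hc k (Finset.mem_range.1 hk), mul_zero]), zero_add, mul_sub, ← mul_assoc,
    mul_one_div_cancel (by positivity)] at hn
  linarith

lemma tendsto_pow_mul_szaszTail_of_isLittleO (j : ℤ) {x A : ℝ} (hx : 0 < x) (hA0 : 0 ≤ A) (M : ℕ)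
    {R : ℝ → ℝ} (hR : ExpBounded A R) (ho : R =o[nhds x] fun t => (t - x) ^ (2 * M)) :
    Tendsto (fun n : ℕ => (n : ℝ) ^ M * szaszTail n j R x) atTop (nhds 0) := by
  obtain ⟨C₁, hC₁⟩ := exists_pow_mul_szaszTail_sub_pow_le j hx M
  obtain ⟨C₂, hC₂⟩ := exists_pow_mul_szaszTail_sub_pow_le j hx (2 * M + 2)
  obtain ⟨C₃, hC₃⟩ := exists_szaszTail_exp_le (by positivity : 0 ≤ 2 * A) j hx.le
  obtain ⟨K, hK⟩ := hR.2
  have hmain (ε : ℝ) (hε : 0 < ε) : ∃ C, ∀ᶠ n : ℕ in atTop,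
      |(n : ℝ) ^ M * szaszTail n j R x| ≤ ε * C₁ + C / n := by
    obtain ⟨δ, hδ, hball⟩ := Metric.eventually_nhds_iff_ball.1 ((Asymptotics.isLittleO_iff.1 ho) hε)
    set L := 2 * M + 2 with hL
    refine ⟨|K| / δ ^ (2 * L) * C₂ + |K| * C₃, ?_⟩
    filter_upwards [hC₁, hC₂, hC₃, eventually_ge_atTop 1,
      (tendsto_natCast_atTop_atTop (R := ℝ)).eventually_gt_atTop (2 * A + 1)]
      with n h1 h2 h3 hn hnA
    have hn' : (0 : ℝ) < n := by exact_mod_cast hn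
    set g₁ : ℝ → ℝ := fun t => (t - x) ^ (2 * M) with hg₁
    set g₂ : ℝ → ℝ := fun t => (t - x) ^ (2 * L) with hg₂
    set g₃ : ℝ → ℝ := fun t => exp (2 * A * t) with hg₃
    have hB : (0 : ℝ) ≤ 2 * A + 1 := by positivity
    have hpoly (r : ℕ) : ExpBounded (2 * A + 1) (fun t => (t - x) ^ r) := by
      have h := (ExpBounded.polynomial ((Polynomial.X - Polynomial.C x) ^ r)).mono
        (by linarith : (1 : ℝ) ≤ 2 * A + 1)
      simpa only [Polynomial.eval_pow, Polynomial.eval_sub, Polynomial.eval_X,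
        Polynomial.eval_C] using h
    have e₁ : ExpBounded (2 * A + 1) (fun t => ε * g₁ t) := (hpoly _).const_mul ε
    have e₂ : ExpBounded (2 * A + 1) (fun t => |K| / δ ^ (2 * L) * n ^ (M + 1) * g₂ t) :=
      (hpoly _).const_mul _
    have e₃ : ExpBounded (2 * A + 1) (fun t => |K| / n ^ (M + 1) * g₃ t) :=
      ((expBounded_exp (2 * A)).mono (by linarith)).const_mul _
    have hle := abs_szaszTail_le (g := R) ((e₁.add e₂).add e₃) hB hnA j hx.le (fun t ht => by
      have p1 : 0 ≤ ε * g₁ t := by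
        rw [hg₁]; dsimp only; rw [pow_mul]; positivity
      have p2 : 0 ≤ |K| / δ ^ (2 * L) * n ^ (M + 1) * g₂ t := by
        rw [hg₂]; dsimp only; rw [pow_mul (t - x)]; positivity
      have p3 : 0 ≤ |K| / n ^ (M + 1) * g₃ t := by positivity
      by_cases htx : t ∈ Metric.ball x δ
      · have := hball t htx
        rw [Real.norm_eq_abs, Real.norm_eq_abs, abs_of_nonneg
          (by rw [pow_mul]; positivity : 0 ≤ (t - x) ^ (2 * M))] at this
        linarith
      · have hδt : δ ≤ |t - x| := by simpa [Real.dist_eq] using htx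
        have h4 : 1 ≤ (|t - x| / δ) ^ L := one_le_pow₀ ((one_le_div hδ).2 hδt)
        set u := (|t - x| / δ) ^ L with hu
        set v := exp (A * t) with hv
        have hv0 : 0 < v := exp_pos _
        set w : ℝ := n ^ (M + 1) with hw
        have hw0 : 0 < w := by positivity
        have h5 : |K| / δ ^ (2 * L) * w * g₂ t = |K| * (w * u ^ 2) := by
          rw [hu, ← pow_mul, mul_comm L 2, div_pow, pow_mul |t - x|, sq_abs, ← pow_mul]
          ring
        have h6 : |K| / w * g₃ t = |K| * (v ^ 2 / w) := by
          rw [hg₃, hv, ← exp_nat_mul]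
          push_cast
          rw [mul_assoc 2 A t]
          ring
        have h7 : v ≤ w * u ^ 2 + v ^ 2 / w := by
          have h8 : u * v ≤ w * u ^ 2 + v ^ 2 / w := by
            have : w * u ^ 2 + v ^ 2 / w - u * v = ((w * u - v / 2) ^ 2 + 3 / 4 * v ^ 2) / w := by
              field_simp
              ring
            have h9 : 0 ≤ ((w * u - v / 2) ^ 2 + 3 / 4 * v ^ 2) / w := by positivity
            linarith
          nlinarith
        have h10 : |R t| ≤ |K| * v := (hK t ht).trans (by gcongr; exact le_abs_self K)
        rw [h5, h6] at *
        nlinarith [mul_le_mul_of_nonneg_left h7 (abs_nonneg K)])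
    rw [szaszTail_add (e₁.add e₂) e₃ hB hnA, szaszTail_add e₁ e₂ hB hnA, szaszTail_const_mul,
      szaszTail_const_mul, szaszTail_const_mul] at hle
    rw [abs_mul, abs_of_nonneg (by positivity : (0 : ℝ) ≤ n ^ M)]
    calc _ ≤ (n : ℝ) ^ M * (ε * szaszTail n j g₁ x +
          |K| / δ ^ (2 * L) * n ^ (M + 1) * szaszTail n j g₂ x +
          |K| / n ^ (M + 1) * szaszTail n j g₃ x) := by gcongr
      _ = ε * (n ^ M * szaszTail n j g₁ x) +
          (|K| / δ ^ (2 * L) * (n ^ L * szaszTail n j g₂ x) + |K| * szaszTail n j g₃ x) / n := by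
          rw [show (n : ℝ) ^ L = n ^ M * n ^ (M + 1) * n by rw [hL]; ring, pow_succ]
          field_simp
          ring
      _ ≤ _ := by gcongr
  rw [Metric.tendsto_atTop']
  intro η hη
  obtain ⟨C, hC⟩ := hmain (η / (2 * (|C₁| + 1))) (by positivity)
  have hlim := tendsto_const_div_atTop_nhds_zero_nat C
  obtain ⟨N, hN⟩ := eventually_atTop.1 (hC.and (hlim.eventually (gt_mem_nhds (half_pos hη))))
  refine ⟨N, fun n hn => ?_⟩
  obtain ⟨h1, h2⟩ := hN n hn.le
  rw [Real.dist_eq, sub_zero]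
  have h3 : η / (2 * (|C₁| + 1)) * C₁ ≤ η / 2 := by
    rw [div_mul_eq_mul_div, div_le_div_iff₀ (by positivity) two_pos]
    nlinarith [le_abs_self C₁]
  linarith

lemma tendsto_Sop_expansion (j : ℤ) (M : ℕ) {x : ℝ} (hx : 0 < x) {f : ℝ → ℝ} {A : ℝ}
    (hf : ExpBounded A f) (hA0 : 0 ≤ A)
    (ho : (fun t => f t - (taylorPoly f x (2 * M)).eval t) =o[nhds x] fun t => (t - x) ^ (2 * M)) :
    Tendsto (fun n : ℕ => (n : ℝ) ^ M * (Sop n j f x - ∑ k ∈ Finset.range (M + 1),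
      1 / (n : ℝ) ^ k * szaszCoeff j x (fun l => iteratedDeriv l f x) k)) atTop (nhds 0) := by
  set P := taylorPoly f x (2 * M) with hP
  have hB : (0 : ℝ) ≤ A + 1 := by positivity
  have hPe : ExpBounded (A + 1) (fun t => P.eval t) :=
    (ExpBounded.polynomial P).mono (by linarith)
  have hRe : ExpBounded (A + 1) (fun t => f t - P.eval t) := by
    simpa [sub_eq_add_neg] using (hf.mono (by linarith)).add (hPe.const_mul (-1))
  have h1 := hasSzaszExpansion_polynomial j hx P M
  have h2 := tendsto_pow_mul_szaszTail_of_isLittleO j hx hB M hRe ho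
  have h3 := (tendsto_pow_mul_sum_szasz hx M j.toNat (fun _ => 1)).const_mul (f 0)
  have h4 := (h3.add h2).add h1
  simp only [mul_zero, add_zero] at h4
  refine h4.congr' ?_
  filter_upwards [(tendsto_natCast_atTop_atTop (R := ℝ)).eventually_gt_atTop (A + 1)] with n hA
  have h5 := szaszTail_add hRe hPe hB hA j x
  simp only [sub_add_cancel] at h5
  have h6 (k : ℕ) (hk : k ∈ Finset.range (M + 1)) :
      1 / (n : ℝ) ^ k * szaszCoeff j x (fun l => (Polynomial.derivative^[l] P).eval x) k =
      1 / (n : ℝ) ^ k * szaszCoeff j x (fun l => iteratedDeriv l f x) k := by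
    congr 1
    refine Finset.sum_congr rfl fun i hi => ?_
    have hk' := Finset.mem_range.1 hk
    have hi' := Finset.mem_range.1 hi
    simp only
    rw [hP, eval_iterate_derivative_taylorPoly f x (by omega)]
  rw [Finset.sum_congr rfl h6, Sop_eq, h5]
  simp only [mul_one]
  ring

lemma tendsto_iteratedDeriv_Sop_expansion {x A : ℝ} {f : ℝ → ℝ} (hf : ExpBounded A f)
    (hA0 : 0 ≤ A) (D : ℕ → ℝ) (N : ℕ)
    (hbase : ∀ j : ℤ, Tendsto (fun n : ℕ => (n : ℝ) ^ N * (Sop n j f x -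
      ∑ k ∈ Finset.range (N + 1), 1 / (n : ℝ) ^ k * szaszCoeff j x D k)) atTop (nhds 0))
    (m : ℕ) : ∀ (q : ℕ) (j : ℤ), q + m = N →
    Tendsto (fun n : ℕ => (n : ℝ) ^ q * (iteratedDeriv m (Sop n j f) x -
      ∑ k ∈ Finset.range (q + 1), 1 / (n : ℝ) ^ k *
        szaszCoeff (j - m) x (fun l => D (l + m)) k)) atTop (nhds 0) := by
  induction m with
  | zero =>
    rintro q j rfl
    simpa using hbase j
  | succ m ih =>
    intro q j hq
    have h := (ih (q + 1) (j - 1) (by omega)).sub (ih (q + 1) j (by omega))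
    rw [sub_zero] at h
    refine h.congr' ?_
    filter_upwards [eventually_ge_atTop 1,
      (tendsto_natCast_atTop_atTop (R := ℝ)).eventually_gt_atTop A] with n hn hA
    have hn' : (0 : ℝ) < n := by exact_mod_cast hn
    have hc : ∑ k ∈ Finset.range (q + 1 + 1), 1 / (n : ℝ) ^ k *
          szaszCoeff (j - 1 - m) x (fun l => D (l + m)) k -
        ∑ k ∈ Finset.range (q + 1 + 1), 1 / (n : ℝ) ^ k *
          szaszCoeff (j - m) x (fun l => D (l + m)) k =
        1 / n * ∑ k ∈ Finset.range (q + 1), 1 / (n : ℝ) ^ k *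
          szaszCoeff (j - (m + 1 : ℕ)) x (fun l => D (l + (m + 1))) k := by
      rw [← Finset.sum_sub_distrib, Finset.sum_range_succ', Finset.mul_sum]
      simp only [szaszCoeff_zero, sub_self, add_zero]
      refine Finset.sum_congr rfl fun k _ => ?_
      rw [← mul_sub, show j - 1 - (m : ℤ) = j - m - 1 by ring, szaszCoeff_sub_one_sub,
        show j - ((m + 1 : ℕ) : ℤ) = j - m - 1 by push_cast; ring, pow_succ]
      simp only [add_right_comm, add_assoc]
      field_simp
    rw [iteratedDeriv_succ_Sop hf hA0 hA, ← mul_sub, sub_sub_sub_comm, hc]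
    field_simp
    ring

/-- Asymptotic expansion for simultaneous approximation, explicit form. -/
theorem stmt_14 (j : ℤ) (q m : ℕ) (x : ℝ) (hx : 0 < x) (f : ℝ → ℝ)
    (hfE : ∃ A ≥ (0 : ℝ), MemE A f)
    (hdiff : ∃ U ∈ nhds x,
      (∀ i < 2 * q + 2 * m - 1, ∀ y ∈ U, DifferentiableAt ℝ (iteratedDeriv i f) y) ∧
      DifferentiableAt ℝ (iteratedDeriv (2 * q + 2 * m - 1) f) x) :
    Filter.Tendsto (fun n : ℕ => (n : ℝ) ^ q *
      (iteratedDeriv m (fun y => Sop n j f y) x -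
        ∑ k ∈ Finset.range (q + 1), (1 / (n : ℝ) ^ k) *
          ∑ i ∈ Finset.range (k + 1),
            (x ^ i / (Nat.factorial i)) *
              ((ffall ((k : ℤ) + m - j) (k - i) : ℝ) / (Nat.factorial (k - i))) *
              iteratedDeriv (k + m + i) f x))
      Filter.atTop (nhds 0) := by
  obtain ⟨A, hA0, hfA⟩ := hfE
  obtain ⟨U, hU, hdU, hdx⟩ := hdiff
  have ho : (fun t => f t - (taylorPoly f x (2 * (q + m))).eval t) =o[nhds x]
      fun t => (t - x) ^ (2 * (q + m)) := by
    rcases Nat.eq_zero_or_pos (q + m) with h0 | hpos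
    · obtain ⟨rfl, rfl⟩ : q = 0 ∧ m = 0 := by omega
      have hc : ContinuousAt f x := by simpa using hdx.continuousAt
      have h := Filter.Tendsto.sub_const hc (f x)
      rw [sub_self] at h
      simpa [taylorPoly, Asymptotics.isLittleO_one_iff] using h
    · obtain ⟨N, hN⟩ : ∃ N, 2 * (q + m) = N + 1 := ⟨2 * (q + m) - 1, by omega⟩
      rw [show 2 * q + 2 * m - 1 = N by omega] at hdU hdx
      rw [hN]
      exact sub_taylorPoly_isLittleO N (fun i hi => Filter.mem_of_superset hU (hdU i hi)) hdx
  have h := tendsto_iteratedDeriv_Sop_expansion (x := x) hfA.expBounded hA0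
    (fun l => iteratedDeriv l f x) (q + m)
    (fun j => tendsto_Sop_expansion j (q + m) hx hfA.expBounded hA0 ho) m q j rfl
  refine h.congr fun n => ?_
  simp only [szaszCoeff, ffall_div_factorial]
  simp only [add_right_comm _ _ m, sub_sub_eq_add_sub]
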